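/- Let d, K ≥ 1, 𝒳 = ℝ^d with the ℓ²-norm, 𝒴 = Fin K, ε > 0, Q : (𝒳 × 𝒴) → 𝒳 → 𝒳 a measurable perturbation operator with ‖Q (x,y) v − x‖_∞ ≤ ε for all inputs, U the uniform probability measure on the ℓ^∞-ball [−ε,ε]^d, and μ a probability measure on 𝒳 × 𝒴. Let f : 𝒳 × 𝒴 → ℝ be measurable, B-bounded and β-Lipschitz in its first argument. Let Z = ((x₁,y₁),…,(x_m,y_m)) and Ẑ = ((x̂₁,ŷ₁),…,(x̂_m,ŷ_m)) be two independent i.i.d. samples from μ, and define G(x,y) := E_{ρ∼U} f(Q (x,y) (x+ρ), y). Then E_Z E_{Ẑ} |(1/m)·Σ_{i=1}^m G(x_i,y_i) − (1/m)·Σ_{i=1}^m G(x̂_i,ŷ_i)| ≤ 2(β√d·ε + B)/√m. -/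

import Mathlib

open MeasureTheory

/-- The mean absolute deviation is at most the standard deviation. -/
lemma integral_abs_sub_mean_le_sqrt_variance {Ω : Type*} [MeasurableSpace Ω] {P : Measure Ω}
    [IsProbabilityMeasure P] {X : Ω → ℝ} (hX : MemLp X 2 P) :
    ∫ ω, |X ω - ∫ ω', X ω' ∂P| ∂P ≤ Real.sqrt (ProbabilityTheory.variance X P) := by
  set c := ∫ ω', X ω' ∂P
  have hY : MemLp (fun ω => |X ω - c|) 2 P := (hX.sub (memLp_const c)).abs
  have h := ProbabilityTheory.variance_nonneg (fun ω => |X ω - c|) P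
  rw [ProbabilityTheory.variance_eq_sub hY] at h
  apply Real.le_sqrt_of_sq_le
  rw [ProbabilityTheory.variance_eq_integral hX.aemeasurable]
  simpa only [Pi.pow_apply, sq_abs, sub_nonneg] using h

/-- The variance of an i.i.d. sample mean of a function bounded by `B` is at most `B ^ 2 / m`. -/
lemma variance_sample_mean_le {Ω : Type*} [MeasurableSpace Ω] {μ : Measure Ω}
    [IsProbabilityMeasure μ] {G : Ω → ℝ} (hG : Measurable G) {B : ℝ} (hB : ∀ u, |G u| ≤ B)
    {m : ℕ} (hm : 1 ≤ m) :
    ProbabilityTheory.variance (fun z : Fin m → Ω => (1 / m : ℝ) * ∑ i, G (z i))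
      (Measure.pi fun _ : Fin m => μ) ≤ B ^ 2 / m := by
  have hL : MemLp G 2 μ := MemLp.of_bound hG.aestronglyMeasurable B (.of_forall hB)
  have hv : ProbabilityTheory.variance G μ ≤ B ^ 2 := by
    have h := ProbabilityTheory.variance_le_sq_of_bounded (μ := μ) (a := -B) (b := B)
      (.of_forall fun u => abs_le.mp (hB u)) hG.aemeasurable
    convert h using 1
    ring
  have hs := ProbabilityTheory.variance_sum_pi (μ := fun _ : Fin m => μ) (X := fun _ => G)
    fun _ => hL
  have he : (∑ i, fun z : Fin m → Ω => G (z i)) = fun z => ∑ i, G (z i) := by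
    ext z
    simp
  rw [he, Finset.sum_const, Finset.card_univ, Fintype.card_fin, nsmul_eq_mul] at hs
  have hm0 : (0 : ℝ) < m := by exact_mod_cast hm
  rw [ProbabilityTheory.variance_const_mul, hs]
  calc (1 / m : ℝ) ^ 2 * (m * ProbabilityTheory.variance G μ)
      = ProbabilityTheory.variance G μ / m := by field_simp
    _ ≤ B ^ 2 / m := by gcongr

/-- The expected distance between two independent copies is at most twice the mean absolute
deviation from any constant. -/
lemma integral_integral_abs_sub_le {Ω : Type*} [MeasurableSpace Ω] {P : Measure Ω}
    [IsProbabilityMeasure P] {X : Ω → ℝ} (hX : Integrable X P) (c : ℝ) :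
    ∫ z, ∫ zh, |X z - X zh| ∂P ∂P ≤ 2 * ∫ z, |X z - c| ∂P := by
  have hY : Integrable (fun z => |X z - c|) P := (hX.sub (integrable_const c)).abs
  have hin (z : Ω) : ∫ zh, |X z - X zh| ∂P ≤ |X z - c| + ∫ zh, |X zh - c| ∂P := by
    calc ∫ zh, |X z - X zh| ∂P ≤ ∫ zh, (|X z - c| + |X zh - c|) ∂P := by
          apply integral_mono ((integrable_const (X z)).sub hX).abs ((integrable_const _).add hY)
          intro zh
          have h := abs_sub_le (X z) c (X zh)
          rwa [abs_sub_comm c (X zh)] at h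
      _ = |X z - c| + ∫ zh, |X zh - c| ∂P := by
          rw [integral_add (integrable_const _) hY]
          simp
  calc ∫ z, ∫ zh, |X z - X zh| ∂P ∂P
      ≤ ∫ z, (|X z - c| + ∫ zh, |X zh - c| ∂P) ∂P :=
        integral_mono_of_nonneg (.of_forall fun z => integral_nonneg fun zh => abs_nonneg _)
          (hY.add (integrable_const _)) (.of_forall hin)
    _ = 2 * ∫ z, |X z - c| ∂P := by
        rw [integral_add hY (integrable_const _)]
        simp
        ring

/-- Two independent i.i.d. sample means of a function bounded by `B` differ in expectation by
at most `2 * B / √m`. -/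
lemma integral_abs_sub_sample_mean_le {Ω : Type*} [MeasurableSpace Ω] {μ : Measure Ω}
    [IsProbabilityMeasure μ] {G : Ω → ℝ} (hG : Measurable G) {B : ℝ} (hB0 : 0 ≤ B)
    (hB : ∀ u, |G u| ≤ B) {m : ℕ} (hm : 1 ≤ m) :
    (∫ z, ∫ zh, |(1 / m : ℝ) * ∑ i, G (z i) - (1 / m : ℝ) * ∑ i, G (zh i)|
        ∂(Measure.pi fun _ : Fin m => μ) ∂(Measure.pi fun _ : Fin m => μ)) ≤
      2 * B / Real.sqrt m := by
  set P := Measure.pi fun _ : Fin m => μ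
  set A : (Fin m → Ω) → ℝ := fun z => (1 / m : ℝ) * ∑ i, G (z i)
  have hAL : MemLp A 2 P := by
    have hi (i : Fin m) : MemLp (fun z : Fin m → Ω => G (z i)) 2 P :=
      MemLp.of_bound (hG.comp (measurable_pi_apply i)).aestronglyMeasurable B
        (Filter.Eventually.of_forall fun z : Fin m → Ω => hB (z i))
    exact (memLp_finsetSum Finset.univ fun i _ => hi i).const_mul _
  calc ∫ z, ∫ zh, |A z - A zh| ∂P ∂P
      ≤ 2 * ∫ z, |A z - ∫ z', A z' ∂P| ∂P :=
        integral_integral_abs_sub_le (hAL.integrable one_le_two) _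
    _ ≤ 2 * Real.sqrt (B ^ 2 / m) := by
        gcongr
        exact (integral_abs_sub_mean_le_sqrt_variance hAL).trans
          (Real.sqrt_le_sqrt (variance_sample_mean_le hG hB hm))
    _ = 2 * B / Real.sqrt m := by
        rw [Real.sqrt_div (sq_nonneg B), Real.sqrt_sq hB0, mul_div_assoc]

/-- A normalized restriction of a measure has total mass at most one. -/
lemma inv_smul_restrict_univ_le_one {Ω : Type*} [MeasurableSpace Ω] (ν : Measure Ω)
    (S : Set Ω) : ((ν S)⁻¹ • ν.restrict S) Set.univ ≤ 1 := by
  simp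

/-- Bound on the base-point-fluctuation term: the expected deviation between the
perturbation-averaged empirical losses of two independent i.i.d. samples from `μ` is
at most `2(β√d·ε + B)/√m`. Expectations over the two independent i.i.d. samples are
written as iterated integrals with respect to the product measure `μ^m`. -/
theorem base_point_fluctuation_bound
    (d K : ℕ) (hd : 1 ≤ d) (hK : 1 ≤ K) (ε : ℝ) (hε : 0 < ε)
    (Q : (EuclideanSpace ℝ (Fin d) × Fin K) → EuclideanSpace ℝ (Fin d) → EuclideanSpace ℝ (Fin d))
    (hQmeas : Measurable fun p : (EuclideanSpace ℝ (Fin d) × Fin K) × EuclideanSpace ℝ (Fin d) =>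
      Q p.1 p.2)
    (hQε : ∀ (x : EuclideanSpace ℝ (Fin d)) (y : Fin K) (v : EuclideanSpace ℝ (Fin d)) (j : Fin d),
      |Q (x, y) v j - x j| ≤ ε)
    (U : Measure (EuclideanSpace ℝ (Fin d)))
    (hU : U = (volume {v : EuclideanSpace ℝ (Fin d) | ∀ j, |v j| ≤ ε})⁻¹ •
      volume.restrict {v : EuclideanSpace ℝ (Fin d) | ∀ j, |v j| ≤ ε})
    (μ : Measure (EuclideanSpace ℝ (Fin d) × Fin K)) [IsProbabilityMeasure μ]
    (f : EuclideanSpace ℝ (Fin d) × Fin K → ℝ) (hfmeas : Measurable f)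
    (B : ℝ) (hB : ∀ u, |f u| ≤ B)
    (β : ℝ) (hβ : ∀ (x x' : EuclideanSpace ℝ (Fin d)) (y : Fin K),
      |f (x, y) - f (x', y)| ≤ β * ‖x - x'‖)
    (m : ℕ) (hm : 1 ≤ m)
    (G : EuclideanSpace ℝ (Fin d) × Fin K → ℝ)
    (hG : ∀ (x : EuclideanSpace ℝ (Fin d)) (y : Fin K),
      G (x, y) = ∫ ρ, f (Q (x, y) (x + ρ), y) ∂U) :
    (∫ z, ∫ zh, |(1 / m : ℝ) * ∑ i, G (z i) - (1 / m : ℝ) * ∑ i, G (zh i)|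
        ∂(Measure.pi fun _ : Fin m => μ) ∂(Measure.pi fun _ : Fin m => μ)) ≤
      2 * (β * Real.sqrt d * ε + B) / Real.sqrt m := by
  have hU1 : U Set.univ ≤ 1 := hU ▸ inv_smul_restrict_univ_le_one _ _
  have : IsFiniteMeasure U := ⟨hU1.trans_lt ENNReal.one_lt_top⟩
  have hβ0 : (0 : ℝ) ≤ β := by
    have h := hβ (EuclideanSpace.single ⟨0, hd⟩ 1) 0 ⟨0, hK⟩
    simp only [sub_zero, PiLp.norm_single, norm_one, mul_one] at h
    exact (abs_nonneg _).trans h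
  have hB0 : 0 ≤ B := (abs_nonneg _).trans (hB (0, ⟨0, hK⟩))
  have hGm : Measurable G := by
    have hG' : G = fun u => ∫ ρ, f (Q u (u.1 + ρ), u.2) ∂U := by
      ext ⟨x, y⟩
      exact hG x y
    rw [hG']
    refine (StronglyMeasurable.integral_prod_right' (ν := U)
      (f := fun p => f (Q p.1 (p.1.1 + p.2), p.1.2)) ?_).measurable
    refine (hfmeas.comp (Measurable.prodMk ?_ (by fun_prop))).stronglyMeasurable
    exact hQmeas.comp (g := fun p => Q p.1 p.2)
      (f := fun p : (EuclideanSpace ℝ (Fin d) × Fin K) × EuclideanSpace ℝ (Fin d) =>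
        (p.1, p.1.1 + p.2)) (by fun_prop)
  have hGB (u : EuclideanSpace ℝ (Fin d) × Fin K) : |G u| ≤ B := by
    rw [← Prod.mk.eta (p := u), hG]
    have h := norm_integral_le_of_norm_le_const (μ := U) (C := B)
      (f := fun ρ => f (Q (u.1, u.2) (u.1 + ρ), u.2)) (.of_forall fun ρ => hB _)
    refine h.trans ?_
    exact mul_le_of_le_one_right hB0 (ENNReal.toReal_mono ENNReal.one_ne_top hU1)
  refine (integral_abs_sub_sample_mean_le hGm hB0 hGB hm).trans ?_
  gcongr
  have : 0 ≤ β * Real.sqrt d * ε := by positivity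
  linarith
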